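/- Let (A,B) be a mixed-4-separation⁺ in a 4-connected graph G. The left-right-reduction (A'',B'') of (A,B) is a tetra-separation if and only if the following three conditions are satisfied: (1) |A \ B| ≥ 2; (2) the number of vertices in S(A,B) with at most one neighbour in A \ B is at least 2 − |B \ A|; (3) |B \ A| ≥ 2 or S(A,B) contains at most one edge. -/

import Mathlib

open Set

namespace Paper

variable {V : Type*}

/-- The set of edges of `G` with one endvertex in `A \ B` and the other in `B \ A`. -/
def sepEdges (G : SimpleGraph V) (A B : Set V) : Set (Sym2 V) :=
  {e | e ∈ G.edgeSet ∧ ∃ a b : V, e = s(a, b) ∧ a ∈ A \ B ∧ b ∈ B \ A}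

/-- The order of the mixed-separation `(A, B)`: the number of vertices of `A ∩ B`
plus the number of edges between `A \ B` and `B \ A`. -/
noncomputable def sepOrder (G : SimpleGraph V) (A B : Set V) : ℕ∞ :=
  (A ∩ B).encard + (sepEdges G A B).encard

/-- A mixed-separation⁺: a pair of vertex sets covering the whole graph. -/
def IsMixedSepPlus (A B : Set V) : Prop := A ∪ B = Set.univ

/-- A (proper) mixed-separation. -/
def IsMixedSep (A B : Set V) : Prop :=
  A ∪ B = Set.univ ∧ (A \ B).Nonempty ∧ (B \ A).Nonempty

/-- `G` is `k`-connected: it has more than `k` vertices and deleting fewer than `k`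
vertices keeps it connected. -/
def KConnected (G : SimpleGraph V) (k : ℕ) : Prop :=
  (k : ℕ∞) < (Set.univ : Set V).encard ∧
    ∀ X : Set V, X.encard < (k : ℕ∞) → (G.induce (Xᶜ : Set V)).Connected

/-- Every vertex of `A ∩ B` has at least two neighbours in `A \ B`
and at least two neighbours in `B \ A`. -/
def DegreeCondition (G : SimpleGraph V) (A B : Set V) : Prop :=
  ∀ v ∈ A ∩ B,
    2 ≤ (G.neighborSet v ∩ (A \ B)).encard ∧ 2 ≤ (G.neighborSet v ∩ (B \ A)).encard

/-- No two edges in the separator of `(A,B)` share an endvertex. -/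
def MatchingCondition (G : SimpleGraph V) (A B : Set V) : Prop :=
  ∀ e ∈ sepEdges G A B, ∀ f ∈ sepEdges G A B, e ≠ f → ∀ v : V, v ∈ e → v ∉ f

/-- A tetra-separation. -/
def IsTetraSep (G : SimpleGraph V) (A B : Set V) : Prop :=
  IsMixedSep A B ∧ sepOrder G A B = 4 ∧ DegreeCondition G A B ∧ MatchingCondition G A B

/-- `(A,B) ≤ (C,D)`. -/
def LeSep (A B C D : Set V) : Prop := A ⊆ C ∧ D ⊆ B

/-- `(A,B)` and `(C,D)` are nested. -/
def Nested (A B C D : Set V) : Prop :=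
  LeSep A B C D ∨ LeSep A B D C ∨ LeSep B A C D ∨ LeSep B A D C

/-- `(A,B)` and `(C,D)` cross. -/
def Crosses (A B C D : Set V) : Prop := ¬ Nested A B C D

/-- The corner for the sides `A` and `C` of the pair `(A,B)`, `(C,D)`. -/
def corner (A B C D : Set V) : Set V := (A \ B) ∩ (C \ D)

/-- The vertex-centre of the crossing-diagram of `(A,B)` and `(C,D)`. -/
def vertexCentre (A B C D : Set V) : Set V := A ∩ B ∩ C ∩ D

/-- An edge is diagonal if its endvertices lie in opposite corners. -/
def IsDiagonal (G : SimpleGraph V) (A B C D : Set V) (e : Sym2 V) : Prop :=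
  e ∈ G.edgeSet ∧ ∃ a b : V, e = s(a, b) ∧
    ((a ∈ corner A B C D ∧ b ∈ corner B A D C) ∨
     (a ∈ corner A B D C ∧ b ∈ corner B A C D))

/-- The `C`-link of the crossing diagram of `(A,B)` and `(C,D)`: all non-diagonal
edges of `S(A,B)` with an endvertex in the corner for `AC` or for `BC`, together with
all vertices of `(C \ D) ∩ S(A,B)`.  (The `D`-link is `link G A B D C`, the `A`-link
is `link G C D A B`, the `B`-link is `link G C D B A`.) -/
def link (G : SimpleGraph V) (A B C D : Set V) : Set (V ⊕ Sym2 V) :=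
  Sum.inl '' ((C \ D) ∩ (A ∩ B)) ∪
    Sum.inr '' {e | e ∈ sepEdges G A B ∧ ¬ IsDiagonal G A B C D e ∧
      ∃ v : V, v ∈ e ∧ (v ∈ corner A B C D ∨ v ∈ corner B A C D)}

/-- The centre: the vertex-centre together with all diagonal edges. -/
def centre (G : SimpleGraph V) (A B C D : Set V) : Set (V ⊕ Sym2 V) :=
  Sum.inl '' vertexCentre A B C D ∪ Sum.inr '' {e | IsDiagonal G A B C D e}

/-- The corner-separator `L(A,C)`: the union of the `A`-link, the `C`-link, the
vertex-centre and the diagonal edges with an endvertex in the corner for `AC`. -/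
def cornerSep (G : SimpleGraph V) (A B C D : Set V) : Set (V ⊕ Sym2 V) :=
  link G C D A B ∪ link G A B C D ∪ Sum.inl '' vertexCentre A B C D ∪
    Sum.inr '' {e | IsDiagonal G A B C D e ∧ ∃ v : V, v ∈ e ∧ v ∈ corner A B C D}

/-- An edge is jumping if its endvertices lie in opposite links. -/
def IsJumping (G : SimpleGraph V) (A B C D : Set V) (e : Sym2 V) : Prop :=
  e ∈ G.edgeSet ∧ ∃ a b : V, e = s(a, b) ∧
    ((Sum.inl a ∈ link G C D A B ∧ Sum.inl b ∈ link G C D B A) ∨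
     (Sum.inl a ∈ link G A B C D ∧ Sum.inl b ∈ link G A B D C))

/-- An edge dangles from `fromLink` through `throughLink` if it has an endvertex
that is a vertex of `fromLink` and the edge itself is an element of `throughLink`. -/
def DanglesFromThrough (G : SimpleGraph V) (fromLink throughLink : Set (V ⊕ Sym2 V))
    (e : Sym2 V) : Prop :=
  e ∈ G.edgeSet ∧ (∃ v : V, v ∈ e ∧ Sum.inl v ∈ fromLink) ∧ Sum.inr e ∈ throughLink

/-- The corner for `A` and `C` is potter. -/
def Potter (G : SimpleGraph V) (A B C D : Set V) : Prop :=
  corner A B C D = ∅ ∧ (link G C D A B).encard = 2 ∧ (link G A B C D).encard = 2 ∧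
    ∃ u₁ u₂ u₃ u₄ : V, G.Adj u₁ u₂ ∧ G.Adj u₂ u₃ ∧ G.Adj u₃ u₄ ∧
      List.Nodup [u₁, u₂, u₃, u₄] ∧
      Sum.inl u₂ ∈ link G A B C D ∧ Sum.inr (s(u₁, u₂)) ∈ link G C D A B ∧
      Sum.inl u₃ ∈ link G C D A B ∧ Sum.inr (s(u₃, u₄)) ∈ link G A B C D

/-- All four links have size two and the centre is empty. -/
def LinksTwoCentreEmpty (G : SimpleGraph V) (A B C D : Set V) : Prop :=
  (link G C D A B).encard = 2 ∧ (link G C D B A).encard = 2 ∧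
    (link G A B C D).encard = 2 ∧ (link G A B D C).encard = 2 ∧
    centre G A B C D = ∅

/-- `(A,B)` is half-connected. -/
def HalfConnected (G : SimpleGraph V) (A B : Set V) : Prop :=
  (G.induce (A \ B)).Connected ∨ (G.induce (B \ A)).Connected

/-- First component of the left-reduction of `(A,B)`: delete from `A` the vertices of
`A ∩ B` with at most one neighbour in `A \ B`.  (The left-reduction of `(A,B)` is
`(leftRed G A B, B)`; the right-reduction is `(A, leftRed G B A)`.) -/
def leftRed (G : SimpleGraph V) (A B : Set V) : Set V :=
  A \ {v | v ∈ A ∩ B ∧ (G.neighborSet v ∩ (A \ B)).encard ≤ 1}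

/-- The separator of `(A,B)` as a set of vertices and edges. -/
def sepElems (G : SimpleGraph V) (A B : Set V) : Set (V ⊕ Sym2 V) :=
  Sum.inl '' (A ∩ B) ∪ Sum.inr '' sepEdges G A B

/-- `x̂`: the endvertices of an element of the separator. -/
def hat : V ⊕ Sym2 V → Set V
  | Sum.inl v => {v}
  | Sum.inr e => {w | w ∈ e}

/-- `X̂` for a set `X` of vertices and edges. -/
def hatSet (π : Set (V ⊕ Sym2 V)) : Set V := ⋃ x ∈ π, hat x

/-- Inner vertices of a walk. -/
def innerVerts (G : SimpleGraph V) {u v : V} (p : G.Walk u v) : Set V :=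
  {w | w ∈ p.support ∧ w ≠ u ∧ w ≠ v}

/-- An `X`–`Y` path: a path starting in `X`, ending in `Y`, with no other
vertex in `X ∪ Y`. -/
def IsXYPath (G : SimpleGraph V) (X Y : Set V) {u v : V} (p : G.Walk u v) : Prop :=
  p.IsPath ∧ u ∈ X ∧ v ∈ Y ∧ ∀ w ∈ p.support, w ∈ X ∪ Y → w = u ∨ w = v

/-- A walk avoids a vertex (it is not on the walk) or an edge (it is not used). -/
def WalkAvoids (G : SimpleGraph V) {u v : V} (p : G.Walk u v) (x : V ⊕ Sym2 V) : Prop :=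
  Sum.elim (fun w => w ∉ p.support) (fun e => e ∉ p.edges) x

/-- There are `n` pairwise independent `X`–`Y` paths in `G`
(no path contains an inner vertex of another). -/
def HasIndepPaths (G : SimpleGraph V) (X Y : Set V) (n : ℕ) : Prop :=
  ∃ (a b : Fin n → V) (p : ∀ i, G.Walk (a i) (b i)),
    (∀ i, IsXYPath G X Y (p i)) ∧
      ∀ i j, i ≠ j → ∀ w ∈ innerVerts G (p i), w ∉ (p j).support

/-- Maximum number of pairwise independent `X`–`Y` paths in `G`. -/
noncomputable def maxIndepPaths (G : SimpleGraph V) (X Y : Set V) : ℕ∞ :=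
  sSup {n : ℕ∞ | ∃ m : ℕ, n = (m : ℕ∞) ∧ HasIndepPaths G X Y m}

/-- `(A,B)` strongly separates `X` and `Y`. -/
def StronglySeparates (A B X Y : Set V) : Prop := X ⊆ A \ B ∧ Y ⊆ B \ A

/-- Minimum order of a mixed-separation of `G` strongly separating `X` and `Y`. -/
noncomputable def minSepOrder (G : SimpleGraph V) (X Y : Set V) : ℕ∞ :=
  sInf {n : ℕ∞ | ∃ A B : Set V,
    IsMixedSep A B ∧ StronglySeparates A B X Y ∧ sepOrder G A B = n}

/-- A `k`-separation: a mixed-separation of order `k` whose separator has no edges. -/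
def IsVertexSep (G : SimpleGraph V) (A B : Set V) (k : ℕ) : Prop :=
  IsMixedSep A B ∧ sepEdges G A B = ∅ ∧ sepOrder G A B = (k : ℕ∞)

/-- `G` is quasi-`k`-connected: `(k-1)`-connected and every `(k-1)`-separation has a
side whose proper part is a single vertex. -/
def QuasiConnected (G : SimpleGraph V) (k : ℕ) : Prop :=
  KConnected G (k - 1) ∧
    ∀ A B : Set V, IsVertexSep G A B (k - 1) →
      (A \ B).encard = 1 ∨ (B \ A).encard = 1

/-- `{x₁,x₂}` is 3-linked around the separator `{x₁,x₂,x₃,x₄}`. -/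
def ThreeLinkedAround (G : SimpleGraph V) (x₁ x₂ x₃ x₄ : V ⊕ Sym2 V) : Prop :=
  (∃ e : Sym2 V, x₃ = Sum.inr e) ∨ (∃ e : Sym2 V, x₄ = Sum.inr e) ∨
    (((∃ v : V, x₁ = Sum.inl v) ∨ (∃ v : V, x₂ = Sum.inl v)) ∧
      ∃ a b : V, G.Adj a b ∧ a ∈ hat x₁ ∧ b ∈ hat x₂) ∨
    (∃ (a b : Fin 3 → V) (p : ∀ i, G.Walk (a i) (b i)),
      (∀ i, IsXYPath G (hat x₁) (hat x₂) (p i) ∧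
        WalkAvoids G (p i) x₃ ∧ WalkAvoids G (p i) x₄) ∧
      ∀ i j, i ≠ j → ∀ w ∈ innerVerts G (p i), w ∉ (p j).support)

/-- `G` is 4-angry: 4-connected and every tetra-separation is crossed. -/
def FourAngry (G : SimpleGraph V) : Prop :=
  KConnected G 4 ∧
    ∀ A B : Set V, IsTetraSep G A B → ∃ C D : Set V, IsTetraSep G C D ∧ Crosses A B C D

/-- `G` is a sprinkled `K₄,ₘ`: a set `X` of four vertices, whose complement has
exactly `m` elements, is independent and completely joined to `X`
(edges inside `X` arbitrary). -/
def IsSprinkledK4m (G : SimpleGraph V) (m : ℕ∞) : Prop :=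
  ∃ X : Set V, X.encard = 4 ∧ (Xᶜ : Set V).encard = m ∧
    (∀ a b : V, a ∉ X → b ∉ X → ¬ G.Adj a b) ∧
    ∀ a : V, a ∉ X → ∀ x ∈ X, G.Adj a x

theorem sepEdges_comm (G : SimpleGraph V) (A B : Set V) : sepEdges G A B = sepEdges G B A := by
  ext e
  constructor <;> rintro ⟨he, a, b, rfl, ha, hb⟩ <;> exact ⟨he, b, a, Sym2.eq_swap, hb, ha⟩

theorem sepOrder_comm (G : SimpleGraph V) (A B : Set V) : sepOrder G A B = sepOrder G B A := by
  rw [sepOrder, sepOrder, sepEdges_comm, inter_comm]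

theorem IsTetraSep.symm {G : SimpleGraph V} {A B : Set V} (h : IsTetraSep G A B) :
    IsTetraSep G B A := by
  obtain ⟨⟨hU, hA, hB⟩, ho, hd, hm⟩ := h
  refine ⟨⟨by rw [union_comm, hU], hB, hA⟩, by rw [sepOrder_comm, ho],
    fun v hv => (hd v hv.symm).symm, ?_⟩
  rw [MatchingCondition, sepEdges_comm]
  exact hm

theorem mem_sepEdges {G : SimpleGraph V} {A B : Set V} {a b : V} (h : G.Adj a b)
    (ha : a ∈ A \ B) (hb : b ∈ B \ A) : s(a, b) ∈ sepEdges G A B :=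
  ⟨h, a, b, rfl, ha, hb⟩

/-- A pair of nonadjacent vertices on the two proper sides forces a large order:
replace every edge of the separator by an endvertex different from both. -/
theorem KConnected.le_sepOrder_of_not_adj {G : SimpleGraph V} {k : ℕ} (hG : KConnected G k)
    {A B : Set V} (hU : A ∪ B = univ) {a b : V} (ha : a ∈ A \ B) (hb : b ∈ B \ A)
    (hab : ¬ G.Adj a b) : (k : ℕ∞) ≤ sepOrder G A B := by
  by_contra! hlt
  have hex : ∀ e : Sym2 V, ∃ v : V, e ∈ sepEdges G A B → v ∈ e ∧ v ≠ a ∧ v ≠ b := by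
    intro e
    by_cases he : e ∈ sepEdges G A B
    · obtain ⟨hadj, x, y, rfl, hx, hy⟩ := he
      by_cases hxa : x = a
      · subst hxa
        refine ⟨y, fun _ => ⟨Sym2.mem_mk_right _ _, ?_, ?_⟩⟩
        · rintro rfl
          exact hx.2 hy.1
        · rintro rfl
          exact hab hadj
      · refine ⟨x, fun _ => ⟨Sym2.mem_mk_left _ _, hxa, ?_⟩⟩
        rintro rfl
        exact hx.2 hb.1
    · exact ⟨a, fun h => absurd h he⟩
  choose g hg using hex
  set X : Set V := A ∩ B ∪ g '' sepEdges G A B with hX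
  have hXlt : X.encard < (k : ℕ∞) := by
    refine lt_of_le_of_lt ((encard_union_le _ _).trans ?_) hlt
    exact add_le_add le_rfl (encard_image_le _ _)
  have haX : a ∈ Xᶜ := by
    rintro (h | ⟨e, he, h⟩)
    · exact ha.2 h.2
    · exact (hg e he).2.1 h
  have hbX : b ∈ Xᶜ := by
    rintro (h | ⟨e, he, h⟩)
    · exact hb.2 h.1
    · exact (hg e he).2.2 h
  have step : ∀ u v : (Xᶜ : Set V), (G.induce Xᶜ).Adj u v → u.1 ∈ A \ B → v.1 ∈ A \ B := by
    intro u v huv hu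
    by_contra hv
    have hadj : G.Adj u.1 v.1 := huv
    have hvU : v.1 ∈ A ∪ B := hU ▸ mem_univ _
    have hvX : v.1 ∉ A ∩ B := fun h => v.2 (Or.inl h)
    have hvB : v.1 ∈ B \ A := by
      simp only [mem_sdiff, mem_union, mem_inter_iff] at *
      tauto
    have he := mem_sepEdges hadj hu hvB
    rcases Sym2.mem_iff.1 (hg _ he).1 with h | h
    · exact u.2 (Or.inr ⟨_, he, h⟩)
    · exact v.2 (Or.inr ⟨_, he, h⟩)
  obtain ⟨p⟩ := (hG.2 X hXlt).preconnected ⟨a, haX⟩ ⟨b, hbX⟩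
  have walk : ∀ u v : (Xᶜ : Set V), (G.induce Xᶜ).Walk u v → u.1 ∈ A \ B → v.1 ∈ A \ B := by
    intro u v p
    induction p with
    | nil => exact id
    | cons h _ ih => exact fun hu => ih (step _ _ h hu)
  exact hb.2 (walk _ _ p ha).1

theorem KConnected.le_encard_neighborSet {G : SimpleGraph V} {k : ℕ} (hG : KConnected G k)
    (v : V) : (k : ℕ∞) ≤ (G.neighborSet v).encard := by
  by_contra! hlt
  obtain ⟨b, hb⟩ : ∃ b, b ∉ insert v (G.neighborSet v) := by
    by_contra! hall
    have h1 : (univ : Set V).encard ≤ (G.neighborSet v).encard + 1 :=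
      (encard_le_encard fun x _ => hall x).trans (encard_insert_le _ _)
    exact absurd (hG.1.trans_le h1) (not_lt.2 (Order.add_one_le_of_lt hlt))
  have hbv : b ≠ v := fun h => hb (Or.inl h)
  have hvb : ¬ G.Adj v b := fun h => hb (Or.inr h)
  have hI : insert v (G.neighborSet v) ∩ {v}ᶜ = G.neighborSet v := by
    ext x
    simp only [mem_inter_iff, mem_insert_iff, mem_compl_iff, mem_singleton_iff,
      SimpleGraph.mem_neighborSet]
    constructor
    · tauto
    · exact fun h => ⟨Or.inr h, h.ne'⟩
  have hE : sepEdges G (insert v (G.neighborSet v)) {v}ᶜ = ∅ := by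
    rw [eq_empty_iff_forall_notMem]
    rintro e ⟨hadj, x, y, rfl, hx, hy⟩
    have hxv : x = v := by simpa using hx.2
    subst hxv
    exact hy.2 (Or.inr hadj)
  have h := hG.le_sepOrder_of_not_adj (A := insert v (G.neighborSet v)) (B := {v}ᶜ)
    (by ext x; by_cases hx : x = v <;> simp [hx]) (a := v) (b := b) (by simp) ⟨hbv, hb⟩ hvb
  rw [sepOrder, hI, hE, encard_empty, add_zero] at h
  exact absurd hlt (not_lt.2 h)

theorem encard_neighborSet_le_sepOrder {G : SimpleGraph V} {A B : Set V} (hU : A ∪ B = univ)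
    {a : V} (ha : a ∈ A \ B) (hs : (A \ B).Subsingleton) :
    (G.neighborSet a).encard ≤ sepOrder G A B := by
  have hsub : G.neighborSet a ⊆ A ∩ B ∪ G.neighborSet a ∩ (B \ A) := by
    intro w hw
    have hwU : w ∈ A ∪ B := hU ▸ mem_univ _
    have hwB : w ∈ B := by
      by_contra h
      exact G.loopless.irrefl a (by
        have : w = a := hs ⟨hwU.resolve_right h, h⟩ ha
        rwa [this] at hw)
    by_cases hwA : w ∈ A
    · exact Or.inl ⟨hwA, hwB⟩
    · exact Or.inr ⟨hw, hwB, hwA⟩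
  refine (encard_le_encard hsub).trans ((encard_union_le _ _).trans (add_le_add le_rfl ?_))
  refine encard_le_encard_of_injOn (f := fun w => s(a, w)) ?_ ?_
  · exact fun w hw => mem_sepEdges hw.1 ha hw.2
  · intro x _ y _ hxy
    exact Sym2.congr_right.1 hxy

/-- In a 4-connected graph, mixed-separations have order at least four. -/
theorem KConnected.four_le_sepOrder {G : SimpleGraph V} (hG : KConnected G 4) {A B : Set V}
    (h : IsMixedSep A B) : 4 ≤ sepOrder G A B := by
  obtain ⟨hU, ⟨a, ha⟩, ⟨b, hb⟩⟩ := h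
  by_cases hA : (A \ B).Subsingleton
  · exact (hG.le_encard_neighborSet a).trans (encard_neighborSet_le_sepOrder hU ha hA)
  by_cases hB : (B \ A).Subsingleton
  · rw [sepOrder_comm]
    exact (hG.le_encard_neighborSet b).trans
      (encard_neighborSet_le_sepOrder (by rw [union_comm, hU]) hb hB)
  by_cases hall : ∀ x ∈ A \ B, ∀ y ∈ B \ A, G.Adj x y
  · obtain ⟨a₁, ha₁, a₂, ha₂, hne⟩ := not_subsingleton_iff.1 hA
    obtain ⟨b₁, hb₁, b₂, hb₂, hne'⟩ := not_subsingleton_iff.1 hB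
    have hab : ∀ x ∈ A \ B, ∀ y ∈ B \ A, x ≠ y := fun x hx y hy => (hall x hx y hy).ne
    have h₁ := hab a₁ ha₁ b₁ hb₁
    have h₂ := hab a₁ ha₁ b₂ hb₂
    have h₃ := hab a₂ ha₂ b₁ hb₁
    have h₄ := hab a₂ ha₂ b₂ hb₂
    have hsub : ({s(a₁, b₁), s(a₁, b₂), s(a₂, b₁), s(a₂, b₂)} : Set (Sym2 V)) ⊆
        sepEdges G A B := by
      rintro e (rfl | rfl | rfl | rfl) <;> exact mem_sepEdges (hall _ ‹_› _ ‹_›) ‹_› ‹_›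
    have hcard : ({s(a₁, b₁), s(a₁, b₂), s(a₂, b₁), s(a₂, b₂)} : Set (Sym2 V)).encard = 4 := by
      rw [encard_insert_of_notMem, encard_insert_of_notMem, encard_insert_of_notMem,
        encard_singleton]
      · norm_num
      all_goals
        simp only [mem_insert_iff, mem_singleton_iff, Sym2.eq_iff]
        grind
    rw [← hcard]
    exact (encard_le_encard hsub).trans le_add_self
  · push Not at hall
    obtain ⟨x, hx, y, hy, hxy⟩ := hall
    exact hG.le_sepOrder_of_not_adj hU hx hy hxy

/-- Two separator edges sharing an endvertex `v ∈ A \ B` allow to lower the order by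
moving `v` into the separator. -/
theorem KConnected.notMem_of_mem_sepEdges {G : SimpleGraph V} (hG : KConnected G 4)
    {A B : Set V} (hU : A ∪ B = univ) (hord : sepOrder G A B ≤ 4) (hA : 2 ≤ (A \ B).encard)
    (hB : (B \ A).Nonempty) {e f : Sym2 V} (he : e ∈ sepEdges G A B) (hf : f ∈ sepEdges G A B)
    (hef : e ≠ f) {v : V} (hv : v ∈ A \ B) (hve : v ∈ e) : v ∉ f := by
  intro hvf
  have hne : ∃ w ∈ A \ B, w ≠ v := by
    by_contra! hall
    have : (A \ B).encard ≤ 1 := encard_le_one_iff_subsingleton.2 fun x hx y hy =>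
      (hall x hx).trans (hall y hy).symm
    exact absurd (hA.trans this) (by norm_num)
  obtain ⟨w, hw, hwv⟩ := hne
  have hsep : IsMixedSep A (insert v B) := by
    refine ⟨?_, ⟨w, hw.1, ?_⟩, ?_⟩
    · rw [union_insert, hU, insert_eq_of_mem (mem_univ _)]
    · rintro (h | h)
      exacts [hwv h, hw.2 h]
    · exact hB.mono (sdiff_subset_sdiff_left (subset_insert _ _))
  have h4 := hG.four_le_sepOrder hsep
  have hI : (A ∩ insert v B).encard ≤ (A ∩ B).encard + 1 := by
    rw [inter_insert_of_mem hv.1]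
    exact encard_insert_le _ _
  have hmem : ∀ g, v ∈ g → g ∉ sepEdges G A (insert v B) := by
    rintro g hvg ⟨-, a, b, rfl, ha, hb⟩
    rcases Sym2.mem_iff.1 hvg with rfl | rfl
    · exact ha.2 (Or.inl rfl)
    · exact hb.2 hv.1
  have hsub : insert e (insert f (sepEdges G A (insert v B))) ⊆ sepEdges G A B := by
    rintro g (rfl | rfl | ⟨hg, a, b, rfl, ha, hb⟩)
    · exact he
    · exact hf
    · refine ⟨hg, a, b, rfl, ⟨ha.1, fun h => ha.2 (Or.inr h)⟩, hb.1.resolve_left ?_, hb.2⟩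
      rintro rfl
      exact hb.2 hv.1
  have hE : (sepEdges G A (insert v B)).encard + 1 + 1 ≤ (sepEdges G A B).encard := by
    rw [← encard_insert_of_notMem (hmem f hvf), ← encard_insert_of_notMem]
    · exact encard_le_encard hsub
    · rintro (h | h)
      exacts [hef h, hmem e hve h]
  have h5 : sepOrder G A (insert v B) + 1 ≤ 4 := by
    refine le_trans ?_ hord
    calc sepOrder G A (insert v B) + 1
        ≤ (A ∩ B).encard + 1 + (sepEdges G A (insert v B)).encard + 1 := by
          unfold sepOrder
          gcongr
      _ = (A ∩ B).encard + ((sepEdges G A (insert v B)).encard + 1 + 1) := by ring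
      _ ≤ sepOrder G A B := add_le_add le_rfl hE
  have h6 : (4 : ℕ∞) + 1 ≤ 4 := (add_le_add h4 le_rfl).trans h5
  exact absurd h6 (by norm_num)

theorem KConnected.matchingCondition {G : SimpleGraph V} (hG : KConnected G 4)
    {A B : Set V} (hU : A ∪ B = univ) (hord : sepOrder G A B ≤ 4) (hA : 2 ≤ (A \ B).encard)
    (hB : 2 ≤ (B \ A).encard) : MatchingCondition G A B := by
  intro e he f hf hef v hve
  have hv : v ∈ A \ B ∨ v ∈ B \ A := by
    obtain ⟨-, a, b, rfl, ha, hb⟩ := he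
    rcases Sym2.mem_iff.1 hve with rfl | rfl
    exacts [Or.inl ha, Or.inr hb]
  have hpos : ∀ s : Set V, 2 ≤ s.encard → s.Nonempty := fun s hs =>
    encard_pos.1 (lt_of_lt_of_le (by norm_num) hs)
  rcases hv with hv | hv
  · exact hG.notMem_of_mem_sepEdges hU hord hA (hpos _ hB) he hf hef hv hve
  · rw [sepEdges_comm] at he hf
    exact hG.notMem_of_mem_sepEdges (by rw [union_comm, hU]) (by rwa [sepOrder_comm]) hB
      (hpos _ hA) he hf hef hv hve

theorem IsTetraSep.two_le_encard_diff {G : SimpleGraph V} {A B : Set V}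
    (h : IsTetraSep G A B) : 2 ≤ (A \ B).encard := by
  by_contra! hlt
  obtain ⟨-, ho, hd, hm⟩ := h
  have hs : (A \ B).encard ≤ 1 := Order.le_of_lt_add_one (by simpa [one_add_one_eq_two] using hlt)
  have hI : A ∩ B = ∅ := by
    rw [eq_empty_iff_forall_notMem]
    intro v hv
    exact absurd ((hd v hv).1.trans (encard_le_encard inter_subset_right)) (not_le.2 hlt)
  rw [sepOrder, hI, encard_empty, zero_add] at ho
  obtain ⟨e, f, he, hf, hef⟩ := one_lt_encard_iff.1 (by rw [ho]; norm_num)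
  obtain ⟨-, a, b, rfl, ha, hb⟩ := id he
  obtain ⟨-, c, d, rfl, hc, hd⟩ := id hf
  obtain rfl := encard_le_one_iff_subsingleton.1 hs ha hc
  exact hm _ he _ hf hef a (Sym2.mem_mk_left _ _) (Sym2.mem_mk_left _ _)

theorem leftRed_subset (G : SimpleGraph V) (A B : Set V) : leftRed G A B ⊆ A := sdiff_subset

theorem leftRed_diff (G : SimpleGraph V) (A B : Set V) : leftRed G A B \ B = A \ B := by
  ext x
  simp only [leftRed, mem_sdiff, mem_ofPred_eq, mem_inter_iff]
  tauto

theorem diff_leftRed (G : SimpleGraph V) (A B : Set V) : B \ leftRed G A B =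
    B \ A ∪ {v | v ∈ A ∩ B ∧ (G.neighborSet v ∩ (A \ B)).encard ≤ 1} := by
  ext x
  simp only [leftRed, mem_sdiff, mem_union, mem_ofPred_eq, mem_inter_iff]
  tauto

theorem leftRed_union {G : SimpleGraph V} {A B : Set V} (h : A ∪ B = univ) :
    leftRed G A B ∪ B = univ := by
  rw [← sdiff_union_self, leftRed_diff, sdiff_union_self, h]

theorem two_le_of_mem_leftRed_inter {G : SimpleGraph V} {A B : Set V} {v : V}
    (h : v ∈ leftRed G A B ∩ B) : 2 ≤ (G.neighborSet v ∩ (A \ B)).encard := by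
  by_contra! hlt
  exact h.1.2 ⟨⟨h.1.1, h.2⟩, Order.le_of_lt_add_one (by simpa [one_add_one_eq_two] using hlt)⟩

theorem sepOrder_leftRed_le (G : SimpleGraph V) (A B : Set V) :
    sepOrder G (leftRed G A B) B ≤ sepOrder G A B := by
  set L : Set V := {v | v ∈ A ∩ B ∧ (G.neighborSet v ∩ (A \ B)).encard ≤ 1} with hL
  have hex : ∀ l : V, ∃ e : Sym2 V, l ∈ L → ∀ a ∈ A \ B, G.Adj a l → e = s(a, l) := by
    intro l
    by_cases h : ∃ a ∈ A \ B, G.Adj a l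
    · obtain ⟨a, ha, hal⟩ := h
      refine ⟨s(a, l), fun hl c hc hcl => ?_⟩
      rw [encard_le_one_iff_subsingleton.1 hl.2 ⟨hal.symm, ha⟩ ⟨hcl.symm, hc⟩]
    · exact ⟨s(l, l), fun _ a ha hal => absurd ⟨a, ha, hal⟩ h⟩
  choose g hg using hex
  have hE : sepEdges G (leftRed G A B) B ⊆ sepEdges G A B ∪ g '' L := by
    rintro e ⟨hadj, a, b, rfl, ha, hb⟩
    rw [leftRed_diff] at ha
    rw [diff_leftRed] at hb
    rcases hb with hb | hb
    · exact Or.inl (mem_sepEdges hadj ha hb)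
    · exact Or.inr ⟨b, hb, hg b hb a ha hadj⟩
  have hI : (leftRed G A B ∩ B).encard + L.encard = (A ∩ B).encard := by
    rw [← encard_union_eq]
    · congr 1
      ext x
      simp only [hL, leftRed, mem_sdiff, mem_union, mem_ofPred_eq, mem_inter_iff]
      tauto
    · exact disjoint_left.2 fun x hx hxL => hx.1.2 hxL
  calc sepOrder G (leftRed G A B) B
      ≤ (leftRed G A B ∩ B).encard + ((sepEdges G A B).encard + L.encard) := by
        refine add_le_add le_rfl ((encard_le_encard hE).trans ((encard_union_le _ _).trans ?_))
        exact add_le_add le_rfl (encard_image_le _ _)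
    _ = (leftRed G A B ∩ B).encard + L.encard + (sepEdges G A B).encard := by ring
    _ = sepOrder G A B := by rw [hI, sepOrder]

/-- characterisation of when the left-right-reduction is a
tetra-separation. -/
theorem left_right_reduction_tetra (G : SimpleGraph V) (A B : Set V)
    (hG : KConnected G 4) (hplus : IsMixedSepPlus A B) (hord : sepOrder G A B = 4) :
    IsTetraSep G (leftRed G A B) (leftRed G B (leftRed G A B)) ↔
      (2 ≤ (A \ B).encard ∧
        2 - (B \ A).encard ≤
          {v | v ∈ A ∩ B ∧ (G.neighborSet v ∩ (A \ B)).encard ≤ 1}.encard ∧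
        (2 ≤ (B \ A).encard ∨ (sepEdges G A B).encard ≤ 1)) := by
  set L : Set V := {v | v ∈ A ∩ B ∧ (G.neighborSet v ∩ (A \ B)).encard ≤ 1} with hL
  set A' := leftRed G A B with hA'
  set B' := leftRed G B A' with hB'
  have hBA : B' \ A' = B \ A ∪ L := by rw [hB', leftRed_diff, hA', diff_leftRed]
  have hAB : A \ B ⊆ A' \ B' := by
    rw [← leftRed_diff G A B]
    exact sdiff_subset_sdiff_right (leftRed_subset _ _ _)
  have hdisj : Disjoint (B \ A) L := disjoint_left.2 fun x hx hxL => hx.2 hxL.1.1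
  have hcard : (B' \ A').encard = (B \ A).encard + L.encard := by
    rw [hBA, encard_union_eq hdisj]
  constructor
  · intro h
    refine ⟨?_, ?_, ?_⟩
    · by_contra! hlt
      have hI : A' ∩ B = ∅ := by
        rw [eq_empty_iff_forall_notMem]
        exact fun v hv => absurd ((two_le_of_mem_leftRed_inter hv).trans
          (encard_le_encard inter_subset_right)) (not_le.2 hlt)
      have hsub : A' \ B' ⊆ A \ B := fun x hx =>
        ⟨leftRed_subset _ _ _ hx.1, fun hxB => (hI ▸ ⟨hx.1, hxB⟩ : x ∈ (∅ : Set V))⟩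
      exact absurd (h.two_le_encard_diff.trans (encard_le_encard hsub)) (not_le.2 hlt)
    · rw [tsub_le_iff_left, ← hcard]
      exact h.symm.two_le_encard_diff
    · by_contra! hcon
      obtain ⟨hlt, hE⟩ := hcon
      have hle : (B \ A).encard ≤ 1 :=
        Order.le_of_lt_add_one (by simpa [one_add_one_eq_two] using hlt)
      obtain ⟨e, f, ⟨he, a, b, rfl, ha, hb⟩, ⟨hf, c, d, rfl, hc, hd⟩, hef⟩ :=
        one_lt_encard_iff.1 hE
      obtain rfl := encard_le_one_iff_subsingleton.1 hle hb hd
      have hb' : b ∈ B' \ A' := hBA ▸ Or.inl hb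
      exact h.2.2.2 _ (mem_sepEdges he (hAB ha) hb') _ (mem_sepEdges hf (hAB hc) hb') hef b
        (Sym2.mem_mk_right _ _) (Sym2.mem_mk_right _ _)
  · rintro ⟨h1, h2, -⟩
    rw [tsub_le_iff_left, ← hcard] at h2
    have h1' : 2 ≤ (A' \ B').encard := h1.trans (encard_le_encard hAB)
    have hpos : ∀ s : Set V, 2 ≤ s.encard → s.Nonempty := fun s hs =>
      encard_pos.1 (lt_of_lt_of_le (by norm_num) hs)
    have hU : A' ∪ B' = univ := by
      rw [union_comm]
      exact leftRed_union (by rw [union_comm]; exact leftRed_union hplus)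
    have hle : sepOrder G A' B' ≤ 4 := by
      rw [sepOrder_comm]
      refine (sepOrder_leftRed_le G B A').trans ?_
      rw [sepOrder_comm, ← hord]
      exact sepOrder_leftRed_le G A B
    have hsep : IsMixedSep A' B' := ⟨hU, hpos _ h1', hpos _ h2⟩
    refine ⟨hsep, le_antisymm hle (hG.four_le_sepOrder hsep), fun v hv => ⟨?_, ?_⟩,
      hG.matchingCondition hU hle h1' h2⟩
    · have hvB : v ∈ A' ∩ B := ⟨hv.1, leftRed_subset _ _ _ hv.2⟩
      exact (two_le_of_mem_leftRed_inter hvB).trans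
        (encard_le_encard (inter_subset_inter_right _ hAB))
    · rw [hB', leftRed_diff]
      exact two_le_of_mem_leftRed_inter hv.symm
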